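/- arXiv:1911.10733 — 3 statements merged into one kernel-verified Lean document; each statement's English description precedes it below -/
import Mathlib

section
/- Let A₁, …, Aₙ be positive invertible operators on H with mI ≤ Aⱼ ≤ MI (j = 1, …, n) for some scalars 0 < m < M, let h = M/m, and let F satisfy the arithmetic–harmonic sandwich for the probability vector ω. Then for every r ∈ (0, 1), K(h, −r)⁻¹·F(A₁, …, Aₙ)ʳ ≤ F(A₁ʳ, …, Aₙʳ) ≤ K(h, −r)·F(A₁, …, Aₙ)ʳ. In particular, if F(A₁, …, Aₙ) ≤ I then F(A₁ʳ, …, Aₙʳ) ≤ K(h, −r)·I for r ∈ (0, 1). -/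
noncomputable section

/-- The arithmetic–harmonic sandwich for the probability vector `ω`:
`(∑ ωⱼ Bⱼ⁻¹)⁻¹ ≤ F (B₁, …, Bₙ) ≤ ∑ ωⱼ Bⱼ` for all positive invertible `B₁, …, Bₙ`,
and `F` takes values in the positive invertible operators. -/
def IsAHSandwich {E : Type*} [NormedAddCommGroup E] [InnerProductSpace ℂ E]
    [CompleteSpace E] {n : ℕ} (ω : Fin n → ℝ)
    (F : (Fin n → (E →L[ℂ] E)) → (E →L[ℂ] E)) : Prop :=
  ∀ B : Fin n → (E →L[ℂ] E), (∀ j, 0 ≤ B j) → (∀ j, IsUnit (B j)) →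
    (0 ≤ F B ∧ IsUnit (F B)) ∧
    Ring.inverse (∑ j, ω j • Ring.inverse (B j)) ≤ F B ∧
    F B ≤ ∑ j, ω j • B j

/-- The generalized Kantorovich constant `K(h, p)`, with `K(h, 0) = K(h, 1) = 1`. -/
def Kconst (h p : ℝ) : ℝ :=
  if p = 0 ∨ p = 1 then 1
  else ((h ^ p - h) / ((p - 1) * (h - 1))) *
    (((p - 1) / p) * ((h ^ p - 1) / (h ^ p - h))) ^ p

/-- Bernoulli's inequality for a nonpositive exponent. -/
theorem one_add_sub_mul_le_rpow_neg {r x : ℝ} (hr : 0 ≤ r) (hx : 0 < x) :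
    1 + r - r * x ≤ x ^ (-r) := by
  rw [Real.rpow_def_of_pos hx]
  have h1 := Real.add_one_le_exp (Real.log x * -r)
  have h2 := Real.log_le_sub_one_of_pos hx
  nlinarith

/-- On `[a, b]` the function `t ↦ t ^ (-r)` lies below its chord. -/
theorem rpow_neg_le_chord {a b r t : ℝ} (ha : 0 < a) (hab : a < b) (hr : 0 ≤ r)
    (hat : a ≤ t) (htb : t ≤ b) :
    t ^ (-r) ≤ (b ^ (-r) - a ^ (-r)) / (b - a) * t +
      (b * a ^ (-r) - a * b ^ (-r)) / (b - a) := by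
  have ht : 0 < t := ha.trans_le hat
  have hb : 0 < b := ha.trans hab
  have hba : 0 < b - a := sub_pos.2 hab
  have tangent : ∀ x, 0 < x → t ^ (-r) * (1 + r - r * (x / t)) ≤ x ^ (-r) := fun x hx => by
    calc t ^ (-r) * (1 + r - r * (x / t)) ≤ t ^ (-r) * (x / t) ^ (-r) := by
          gcongr; exact one_add_sub_mul_le_rpow_neg hr (div_pos hx ht)
      _ = x ^ (-r) := by
          rw [← Real.mul_rpow ht.le (div_pos hx ht).le, mul_div_cancel₀ _ ht.ne']
  have h1 := mul_le_mul_of_nonneg_left (tangent a ha) (sub_nonneg.2 htb)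
  have h2 := mul_le_mul_of_nonneg_left (tangent b hb) (sub_nonneg.2 hat)
  have h3 : (b - t) * (t ^ (-r) * (1 + r - r * (a / t))) +
      (t - a) * (t ^ (-r) * (1 + r - r * (b / t))) = t ^ (-r) * (b - a) := by
    field_simp
    ring
  rw [div_mul_eq_mul_div, ← add_div, le_div_iff₀ hba]
  linarith

/-- The chord of `s ↦ s ^ (-r)` over `[1, h]` is bounded by `Kconst h (-r) * s ^ (-r)`. -/
theorem chord_one_le_Kconst_mul_rpow {h r s : ℝ} (hh : 1 < h) (hr : 0 < r) (hs : 0 < s) :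
    ((h - h ^ (-r)) - (1 - h ^ (-r)) * s) / (h - 1) ≤ Kconst h (-r) * s ^ (-r) := by
  have hx1 : h ^ (-r) < 1 := Real.rpow_lt_one_of_one_lt_of_neg hh (neg_neg_of_pos hr)
  rw [Kconst, if_neg (by rintro (h0 | h0) <;> linarith)]
  generalize h ^ (-r) = x at hx1 ⊢
  have hu : 0 < h - x := by linarith
  have hv : 0 < 1 - x := by linarith
  have hh1 : 0 < h - 1 := by linarith
  have e1 : (x - h) / ((-r - 1) * (h - 1)) = (h - x) / ((1 + r) * (h - 1)) := by
    rw [← neg_div_neg_eq]; congr 1 <;> ring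
  have e2 : (-r - 1) / -r * ((x - 1) / (x - h)) = (1 + r) / r * ((1 - x) / (h - x)) := by
    rw [← neg_div_neg_eq (-r - 1), ← neg_div_neg_eq (x - 1)]; congr 2 <;> ring
  have hq : 0 < (1 + r) / r * ((1 - x) / (h - x)) := by positivity
  rw [e1, e2, mul_assoc, ← Real.mul_rpow hq.le hs.le]
  calc ((h - x) - (1 - x) * s) / (h - 1)
      = (h - x) / ((1 + r) * (h - 1)) *
          (1 + r - r * ((1 + r) / r * ((1 - x) / (h - x)) * s)) := by
        field_simp
    _ ≤ _ := by
        gcongr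
        exact one_add_sub_mul_le_rpow_neg hr.le (mul_pos hq hs)

theorem Kconst_neg_pos {h r : ℝ} (hh : 1 < h) (hr : 0 < r) : 0 < Kconst h (-r) := by
  have := chord_one_le_Kconst_mul_rpow hh hr one_pos
  rw [Real.one_rpow, mul_one, mul_one, sub_sub_sub_cancel_right,
    div_self (sub_pos.2 hh).ne'] at this
  linarith

theorem chord_le_Kconst_mul_rpow {a b r t : ℝ} (ha : 0 < a) (hab : a < b) (hr : 0 < r)
    (ht : 0 < t) :
    (b ^ (-r) - a ^ (-r)) / (b - a) * t + (b * a ^ (-r) - a * b ^ (-r)) / (b - a) ≤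
      Kconst (b / a) (-r) * t ^ (-r) := by
  have hba : 0 < b - a := sub_pos.2 hab
  have key := chord_one_le_Kconst_mul_rpow ((one_lt_div ha).2 hab) hr (div_pos ht ha)
  rw [Real.div_rpow (ha.trans hab).le ha.le, Real.div_rpow ht.le ha.le] at key
  have hA : 0 < a ^ (-r) := Real.rpow_pos_of_pos ha _
  have := mul_le_mul_of_nonneg_left key hA.le
  calc _ = _ := ?_
    _ ≤ _ := this
    _ = _ := by field_simp
  have h1 : b / a - 1 = (b - a) / a := by field_simp
  rw [h1]
  field_simp
  ring

theorem cfc_affine {A : Type*} [CStarAlgebra A] (c d : ℝ) {B : A} (hB : IsSelfAdjoint B) :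
    cfc (fun t : ℝ => c * t + d) B = c • B + d • (1 : A) := by
  rw [cfc_add_const d (fun t : ℝ => c * t) B, cfc_const_mul_id c B, Algebra.algebraMap_eq_smul_one]

theorem inverse_smul {A : Type*} [Ring A] [Algebra ℝ A] {a : ℝ} (ha : a ≠ 0) {B : A} (hB : IsUnit B) :
    Ring.inverse (a • B) = a⁻¹ • Ring.inverse B := by
  lift B to Aˣ using hB
  simpa [Units.smul_def] using Ring.inverse_unit (Units.mk0 a ha • B)

section CStarAlgebra

variable {A : Type*} [CStarAlgebra A] [PartialOrder A] [StarOrderedRing A]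

theorem isStrictlyPositive_of_smul_one_le {a : ℝ} (ha : 0 < a) {B : A}
    (h : a • (1 : A) ≤ B) : IsStrictlyPositive B :=
  IsStrictlyPositive.of_le (isStrictlyPositive_one.smul ha) h

theorem continuousOn_rpow_spectrum {B : A} (hB : IsStrictlyPositive B) (p : ℝ) :
    ContinuousOn (fun t : ℝ => t ^ p) (spectrum ℝ B) :=
  continuousOn_id.rpow_const fun _ hx => Or.inl (hB.spectrum_pos hx).ne'

theorem rpow_le_affine {a b c d p : ℝ} (ha : 0 < a)
    (hcd : ∀ t ∈ Set.Icc a b, t ^ p ≤ c * t + d) {B : A}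
    (h1 : a • (1 : A) ≤ B) (h2 : B ≤ b • (1 : A)) :
    B ^ p ≤ c • B + d • (1 : A) := by
  have hB := isStrictlyPositive_of_smul_one_le ha h1
  have hsa := hB.isSelfAdjoint
  rw [← Algebra.algebraMap_eq_smul_one] at h1 h2
  rw [CFC.rpow_eq_cfc_real hB.nonneg, ← cfc_affine c d hsa]
  exact cfc_mono (fun t ht => hcd t ⟨(algebraMap_le_iff_le_spectrum hsa).1 h1 t ht,
    (le_algebraMap_iff_spectrum_le hsa).1 h2 t ht⟩) (continuousOn_rpow_spectrum hB p) (by fun_prop)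

theorem affine_le_smul_rpow {c d K p : ℝ} (hcd : ∀ t, 0 < t → c * t + d ≤ K * t ^ p) {B : A}
    (hB : IsStrictlyPositive B) : c • B + d • (1 : A) ≤ K • B ^ p := by
  have hcont := continuousOn_rpow_spectrum hB p
  rw [CFC.rpow_eq_cfc_real hB.nonneg, ← cfc_affine c d hB.isSelfAdjoint,
    ← cfc_const_mul K _ B hcont]
  exact cfc_mono (fun t ht => hcd t (hB.spectrum_pos ht)) (by fun_prop)
    (continuousOn_const.mul hcont)

theorem isStrictlyPositive_sum_smul {ι : Type*} [Fintype ι] {ω : ι → ℝ} (hω0 : ∀ j, 0 ≤ ω j)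
    (hω1 : ∑ j, ω j = 1) {B : ι → A} (hB : ∀ j, IsStrictlyPositive (B j)) :
    IsStrictlyPositive (∑ j, ω j • B j) := by
  obtain ⟨j, -, hj⟩ := Finset.exists_ne_zero_of_sum_ne_zero (hω1.trans_ne one_ne_zero)
  exact IsStrictlyPositive.of_le ((hB j).smul ((hω0 j).lt_of_ne' hj))
    (Finset.single_le_sum (f := fun j => ω j • B j)
      (fun i _ => smul_nonneg (hω0 i) (hB i).nonneg) (Finset.mem_univ j))

/-- The converse Jensen inequality of Mond–Pečarić type for `t ↦ t ^ (-r)`. -/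
theorem sum_smul_rpow_neg_le {ι : Type*} [Fintype ι] {ω : ι → ℝ} (hω0 : ∀ j, 0 ≤ ω j)
    (hω1 : ∑ j, ω j = 1) {a b r : ℝ} (ha : 0 < a) (hab : a < b) (hr : 0 < r) {B : ι → A}
    (h1 : ∀ j, a • (1 : A) ≤ B j) (h2 : ∀ j, B j ≤ b • (1 : A)) :
    ∑ j, ω j • B j ^ (-r) ≤ Kconst (b / a) (-r) • (∑ j, ω j • B j) ^ (-r) := by
  have hS := isStrictlyPositive_sum_smul hω0 hω1
    fun j => isStrictlyPositive_of_smul_one_le ha (h1 j)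
  refine le_trans ?_ (affine_le_smul_rpow
    (fun t ht => chord_le_Kconst_mul_rpow ha hab hr ht) hS)
  set c := (b ^ (-r) - a ^ (-r)) / (b - a)
  set d := (b * a ^ (-r) - a * b ^ (-r)) / (b - a)
  calc ∑ j, ω j • B j ^ (-r) ≤ ∑ j, ω j • (c • B j + d • (1 : A)) :=
        Finset.sum_le_sum fun j _ => smul_le_smul_of_nonneg_left
          (rpow_le_affine ha (fun t ht => rpow_neg_le_chord ha hab hr.le ht.1 ht.2) (h1 j) (h2 j))
          (hω0 j)
    _ = c • ∑ j, ω j • B j + d • (1 : A) := by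
        simp only [smul_add, Finset.sum_add_distrib, ← Finset.sum_smul, hω1,
          Finset.smul_sum, smul_comm c, smul_smul _ d, ← Finset.sum_mul, one_mul]

theorem inverse_rpow_eq_rpow_neg {B : A} (hB : IsStrictlyPositive B) {r : ℝ} :
    Ring.inverse B ^ r = B ^ (-r) := by
  rw [CFC.inverse_eq_rpow_neg_one hB, CFC.rpow_rpow B _ _ (by simp) hB, neg_one_mul]

end CStarAlgebra

theorem stmt13
    {H : Type*}
    [NormedAddCommGroup H] [InnerProductSpace ℂ H] [CompleteSpace H]
    {n : ℕ} (ω : Fin n → ℝ) (hω0 : ∀ j, 0 ≤ ω j) (hω1 : ∑ j, ω j = 1)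
    (m M : ℝ) (hm : 0 < m) (hmM : m < M)
    (A : Fin n → (H →L[ℂ] H))
    (hA0 : ∀ j, 0 ≤ A j) (hAu : ∀ j, IsUnit (A j))
    (hA1 : ∀ j, m • (1 : H →L[ℂ] H) ≤ A j)
    (hA2 : ∀ j, A j ≤ M • (1 : H →L[ℂ] H))
    (F : (Fin n → (H →L[ℂ] H)) → (H →L[ℂ] H))
    (hF : IsAHSandwich ω F)
    (r : ℝ) (hr : r ∈ Set.Ioo (0 : ℝ) 1)
    :
    ((Kconst (M / m) (-r))⁻¹ • CFC.rpow (F A) r ≤ F (fun j => CFC.rpow (A j) r) ∧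
      F (fun j => CFC.rpow (A j) r) ≤ Kconst (M / m) (-r) • CFC.rpow (F A) r) ∧
      (F A ≤ 1 → F (fun j => CFC.rpow (A j) r) ≤ Kconst (M / m) (-r) • (1 : H →L[ℂ] H)) := by
  have hM : 0 < M := hm.trans hmM
  have hh : 1 < M / m := (one_lt_div hm).2 hmM
  have hK := Kconst_neg_pos hh hr.1
  have hrI : r ∈ Set.Icc (0 : ℝ) 1 := ⟨hr.1.le, hr.2.le⟩
  have hA : ∀ j, IsStrictlyPositive (A j) := fun j => (hAu j).isStrictlyPositive (hA0 j)
  have hAr : ∀ j, IsStrictlyPositive (A j ^ r) := fun j => IsStrictlyPositive.rpow _ _ (hA j)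
  simp only [CFC.rpow_eq_pow]
  obtain ⟨-, hFA_lower, hFA_upper⟩ := hF A hA0 hAu
  obtain ⟨-, hFr_lower, hFr_upper⟩ :=
    hF (fun j => A j ^ r) (fun j => (hAr j).nonneg) (fun j => (hAr j).isUnit)
  have lower : (Kconst (M / m) (-r))⁻¹ • F A ^ r ≤ F (fun j => A j ^ r) := by
    have hS : IsStrictlyPositive (∑ j, ω j • A j) :=
      isStrictlyPositive_sum_smul hω0 hω1 hA
    have hT : IsStrictlyPositive (∑ j, ω j • A j ^ (-r)) :=
      isStrictlyPositive_sum_smul hω0 hω1 fun j => IsStrictlyPositive.rpow _ _ (hA j)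
    calc (Kconst (M / m) (-r))⁻¹ • F A ^ r
        ≤ (Kconst (M / m) (-r))⁻¹ • (∑ j, ω j • A j) ^ r :=
          smul_le_smul_of_nonneg_left (CFC.rpow_le_rpow hrI hFA_upper) (inv_nonneg.2 hK.le)
      _ = Ring.inverse (Kconst (M / m) (-r) • (∑ j, ω j • A j) ^ (-r)) := by
          rw [inverse_smul hK.ne' (IsStrictlyPositive.rpow _ _ hS).isUnit,
            CFC.inverse_rpow _ _ (neg_ne_zero.2 hr.1.ne') hS, neg_neg]
      _ ≤ Ring.inverse (∑ j, ω j • A j ^ (-r)) :=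
          CStarAlgebra.ringInverse_le_ringInverse
            (sum_smul_rpow_neg_le hω0 hω1 hm hmM hr.1 hA1 hA2) hT
      _ = Ring.inverse (∑ j, ω j • Ring.inverse (A j ^ r)) := by
          simp only [fun j => CFC.inverse_rpow (A j) r hr.1.ne' (hA j)]
      _ ≤ _ := hFr_lower
  have upper : F (fun j => A j ^ r) ≤ Kconst (M / m) (-r) • F A ^ r := by
    have hB1 : ∀ j, M⁻¹ • (1 : H →L[ℂ] H) ≤ Ring.inverse (A j) := fun j => by
      simpa [inverse_smul hM.ne' isUnit_one] using
        CStarAlgebra.ringInverse_le_ringInverse (hA2 j) (hA j)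
    have hB2 : ∀ j, Ring.inverse (A j) ≤ m⁻¹ • (1 : H →L[ℂ] H) := fun j => by
      simpa [inverse_smul hm.ne' isUnit_one] using
        CStarAlgebra.ringInverse_le_ringInverse (hA1 j) (isStrictlyPositive_one.smul hm)
    have hS : IsStrictlyPositive (∑ j, ω j • Ring.inverse (A j)) :=
      isStrictlyPositive_sum_smul hω0 hω1
        fun j => isStrictlyPositive_of_smul_one_le (inv_pos.2 hM) (hB1 j)
    calc F (fun j => A j ^ r) ≤ ∑ j, ω j • A j ^ r := hFr_upper
      _ = ∑ j, ω j • Ring.inverse (A j) ^ (-r) := by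
          simp only [fun j => inverse_rpow_eq_rpow_neg (r := -r) (hA j), neg_neg]
      _ ≤ Kconst (m⁻¹ / M⁻¹) (-r) • (∑ j, ω j • Ring.inverse (A j)) ^ (-r) :=
          sum_smul_rpow_neg_le hω0 hω1 (inv_pos.2 hM) (inv_strictAnti₀ hm hmM) hr.1 hB1 hB2
      _ = Kconst (M / m) (-r) • Ring.inverse (∑ j, ω j • Ring.inverse (A j)) ^ r := by
          rw [inverse_rpow_eq_rpow_neg hS, inv_div_inv]
      _ ≤ _ := smul_le_smul_of_nonneg_left (CFC.rpow_le_rpow hrI hFA_lower) hK.le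
  refine ⟨⟨lower, upper⟩, fun hF1 => upper.trans (smul_le_smul_of_nonneg_left ?_ hK.le)⟩
  exact (CFC.rpow_le_rpow hrI hF1).trans_eq CFC.one_rpow
end
end

section
/- Let A₁, …, Aₙ be positive invertible operators on H with mI ≤ Aⱼ ≤ MI (j = 1, …, n) for some scalars 0 < m < M, and let F satisfy the arithmetic–harmonic sandwich for the probability vector ω. Then for every r with 0 < r ≤ 1, F(A₁ʳ, …, Aₙʳ) ≤ ((M + m)²/(4Mm))ʳ·F(A₁, …, Aₙ)ʳ (the reverse Ando–Hiai inequality, which in the paper is stated for the operator power mean P_{ω,α}). -/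
noncomputable section

theorem commute_ringInverse {R : Type*} [MonoidWithZero R] {a : R} (ha : IsUnit a) :
    Commute a (Ring.inverse a) :=
  (Ring.mul_inverse_cancel a ha).trans (Ring.inverse_mul_cancel a ha).symm

section CStarAlgebra

variable {R : Type*} [CStarAlgebra R] [PartialOrder R] [StarOrderedRing R]

theorem CFC.smul_rpow {c r : ℝ} (hc : 0 ≤ c) (hr : 0 < r) {a : R} (ha : 0 ≤ a) :
    (c • a) ^ r = c ^ r • a ^ r := by
  lift c to NNReal using hc
  have hcont : Continuous fun x : NNReal => x ^ r := NNReal.continuous_rpow_const hr.le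
  have hsmul : ∀ (d : NNReal) (b : R), (d : ℝ) • b = d • b := fun _ _ => rfl
  rw [← NNReal.coe_rpow, hsmul, hsmul, CFC.rpow_def, CFC.rpow_def,
    ← cfc_comp_smul c _ a hcont.continuousOn, ← cfc_smul (c ^ r) _ a hcont.continuousOn]
  simp only [smul_eq_mul, NNReal.mul_rpow]

theorem one_le_smul_ringInverse {M : ℝ} {a : R} (ha : IsStrictlyPositive a)
    (haM : a ≤ M • (1 : R)) : 1 ≤ M • Ring.inverse a := by
  have hinv := ha.ringInverse.nonneg
  have hcomm : Commute (M • (1 : R) - a) (Ring.inverse a) :=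
    ((Commute.one_left _).smul_left M).sub_left (commute_ringInverse ha.isUnit)
  have h := Commute.mul_nonneg (sub_nonneg.mpr haM) hinv hcomm
  rw [sub_mul, smul_mul_assoc, one_mul, Ring.mul_inverse_cancel _ ha.isUnit] at h
  exact sub_nonneg.mp h

theorem add_smul_ringInverse_le {m M : ℝ} {a : R} (ha : IsStrictlyPositive a)
    (hma : m • (1 : R) ≤ a) (haM : a ≤ M • (1 : R)) :
    a + (m * M) • Ring.inverse a ≤ (M + m) • (1 : R) := by
  have hinv := ha.ringInverse.nonneg
  have hai := Ring.mul_inverse_cancel _ ha.isUnit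
  have hMa : Commute (M • (1 : R) - a) (Ring.inverse a) :=
    ((Commute.one_left _).smul_left M).sub_left (commute_ringInverse ha.isUnit)
  have hma' : Commute (a - m • (1 : R)) (Ring.inverse a) :=
    (commute_ringInverse ha.isUnit).sub_left ((Commute.one_left _).smul_left m)
  have hmM : Commute (a - m • (1 : R)) (M • (1 : R) - a) :=
    (((Commute.one_right a).smul_right M).sub_right (Commute.refl a)).sub_left
      ((Commute.one_left _).smul_left m)
  have h := Commute.mul_nonneg (sub_nonneg.mpr hma)
    (Commute.mul_nonneg (sub_nonneg.mpr haM) hinv hMa) (hmM.mul_right hma')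
  have heq : (a - m • (1 : R)) * ((M • (1 : R) - a) * Ring.inverse a) =
      (M + m) • (1 : R) - (a + (m * M) • Ring.inverse a) := by
    simp only [sub_mul, mul_sub, smul_mul_assoc, mul_smul_comm, one_mul, mul_one, hai,
      smul_sub, smul_smul]
    module
  exact sub_nonneg.mp (heq ▸ h)

theorem smul_one_sub_le_smul_ringInverse {p q : ℝ} (hq : 0 < q) {t : R}
    (ht : IsStrictlyPositive t) :
    p • (1 : R) - q • t ≤ (p ^ 2 / (4 * q)) • Ring.inverse t := by
  have hsa : IsSelfAdjoint ((p / 2) • (1 : R) - q • t) :=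
    ((IsSelfAdjoint.all (p / 2)).smul (IsSelfAdjoint.one R)).sub
      ((IsSelfAdjoint.all q).smul ht.isSelfAdjoint)
  have h := smul_nonneg (inv_nonneg.mpr hq.le)
    (hsa.conjugate_nonneg ht.ringInverse.nonneg)
  have heq : q⁻¹ • (((p / 2) • (1 : R) - q • t) * Ring.inverse t *
      ((p / 2) • (1 : R) - q • t)) =
      (p ^ 2 / (4 * q)) • Ring.inverse t - (p • (1 : R) - q • t) := by
    simp only [sub_mul, mul_sub, smul_mul_assoc, mul_smul_comm, one_mul, mul_one,
      Ring.mul_inverse_cancel _ ht.isUnit, Ring.inverse_mul_cancel _ ht.isUnit,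
      smul_sub, smul_smul]
    match_scalars <;> field_simp <;> ring
  exact sub_nonneg.mp (heq ▸ h)

/-- The operator Kantorovich inequality between weighted arithmetic and harmonic means. -/
theorem sum_smul_le_smul_ringInverse_sum {ι : Type*} [Fintype ι] {ω : ι → ℝ}
    (hω0 : ∀ j, 0 ≤ ω j) (hω1 : ∑ j, ω j = 1) {m M : ℝ} (hm : 0 < m) (hM : 0 < M)
    {a : ι → R} (ha : ∀ j, IsStrictlyPositive (a j))
    (hma : ∀ j, m • (1 : R) ≤ a j) (haM : ∀ j, a j ≤ M • (1 : R)) :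
    ∑ j, ω j • a j ≤
      ((M + m) ^ 2 / (4 * M * m)) • Ring.inverse (∑ j, ω j • Ring.inverse (a j)) := by
  have hone : ∀ c : ℝ, ∑ j, ω j • (c • (1 : R)) = c • (1 : R) := fun c => by
    rw [← Finset.sum_smul, hω1, one_smul]
  have hT : IsStrictlyPositive (∑ j, ω j • Ring.inverse (a j)) := by
    have h : M⁻¹ • (1 : R) ≤ ∑ j, ω j • Ring.inverse (a j) := by
      rw [← hone]
      refine Finset.sum_le_sum fun j _ => smul_le_smul_of_nonneg_left ?_ (hω0 j)
      simpa [smul_smul, hM.ne'] using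
        smul_le_smul_of_nonneg_left (one_le_smul_ringInverse (ha j) (haM j))
          (inv_nonneg.mpr hM.le)
    exact (isStrictlyPositive_one.smul (inv_pos.mpr hM)).of_le h
  have hsum : ∑ j, ω j • a j + (m * M) • ∑ j, ω j • Ring.inverse (a j) ≤
      (M + m) • (1 : R) := by
    rw [← hone, Finset.smul_sum, ← Finset.sum_add_distrib]
    refine Finset.sum_le_sum fun j _ => ?_
    rw [smul_comm, ← smul_add]
    exact smul_le_smul_of_nonneg_left
      (add_smul_ringInverse_le (ha j) (hma j) (haM j)) (hω0 j)
  refine (le_sub_right_of_add_le hsum).trans ?_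
  convert smul_one_sub_le_smul_ringInverse (p := M + m) (mul_pos hm hM) hT using 3
  ring

end CStarAlgebra

theorem stmt15
    {H : Type*}
    [NormedAddCommGroup H] [InnerProductSpace ℂ H] [CompleteSpace H]
    {n : ℕ} (ω : Fin n → ℝ) (hω0 : ∀ j, 0 ≤ ω j) (hω1 : ∑ j, ω j = 1)
    (m M : ℝ) (hm : 0 < m) (hmM : m < M)
    (A : Fin n → (H →L[ℂ] H))
    (hA0 : ∀ j, 0 ≤ A j) (hAu : ∀ j, IsUnit (A j))
    (hA1 : ∀ j, m • (1 : H →L[ℂ] H) ≤ A j)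
    (hA2 : ∀ j, A j ≤ M • (1 : H →L[ℂ] H))
    (F : (Fin n → (H →L[ℂ] H)) → (H →L[ℂ] H))
    (hF : IsAHSandwich ω F)
    (r : ℝ) (hr0 : 0 < r) (hr1 : r ≤ 1)
    :
    F (fun j => CFC.rpow (A j) r) ≤
      ((M + m) ^ 2 / (4 * M * m)) ^ r • CFC.rpow (F A) r := by
  have hM : 0 < M := hm.trans hmM
  have hr : r ∈ Set.Icc (0 : ℝ) 1 := ⟨hr0.le, hr1⟩
  have hA : ∀ j, IsStrictlyPositive (A j) := fun j => (hAu j).isStrictlyPositive (hA0 j)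
  have hK : 0 ≤ (M + m) ^ 2 / (4 * M * m) := by positivity
  obtain ⟨⟨hF0, -⟩, hlow, -⟩ := hF A hA0 hAu
  obtain ⟨-, -, hup⟩ := hF (fun j => A j ^ r) (fun j => CFC.rpow_nonneg)
    (fun j => (hAu j).cfcRpow r (hA0 j))
  calc F (fun j => A j ^ r) ≤ ∑ j, ω j • A j ^ r := hup
    _ ≤ (∑ j, ω j • A j) ^ r :=
      (CFC.concaveOn_rpow hr).le_map_sum (fun j _ => hω0 j) hω1 (fun j _ => hA0 j)
    _ ≤ (((M + m) ^ 2 / (4 * M * m)) • F A) ^ r :=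
      CFC.rpow_le_rpow hr <|
        (sum_smul_le_smul_ringInverse_sum hω0 hω1 hm hM hA hA1 hA2).trans
          (smul_le_smul_of_nonneg_left hlow hK)
    _ = ((M + m) ^ 2 / (4 * M * m)) ^ r • F A ^ r := CFC.smul_rpow hK hr0 hF0
end
end

section
/- Let h > 1. Then the generalized Kantorovich constant satisfies K(h, −r) ≤ K(h, −1)ʳ for every r ∈ (0, 1), and K(h, −r) ≥ K(h, −1)ʳ for every r ≥ 1, where K(h, −1) = (h + 1)²/(4h). In particular, K(h, −r) < ((M + m)²/(4Mm))ʳ for 0 < r < 1 whenever h = M/m with 0 < m < M. -/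
noncomputable section

/-- Bernoulli's inequality for a negative exponent. -/
theorem one_sub_mul_sub_one_le_rpow_neg {y r : ℝ} (hy : 0 < y) (hr : 0 ≤ r) :
    1 - r * (y - 1) ≤ y ^ (-r) := by
  rw [Real.rpow_def_of_pos hy]
  have h1 := Real.add_one_le_exp (Real.log y * -r)
  have h2 := mul_le_mul_of_nonneg_left (Real.log_le_sub_one_of_pos hy) hr
  linarith

/-- Strict form of Bernoulli's inequality for a negative exponent. -/
theorem one_sub_mul_sub_one_lt_rpow_neg {y r : ℝ} (hy : 0 < y) (hy1 : y ≠ 1) (hr : 0 < r) :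
    1 - r * (y - 1) < y ^ (-r) := by
  rw [Real.rpow_def_of_pos hy]
  have h1 := Real.add_one_le_exp (Real.log y * -r)
  have h2 := mul_lt_mul_of_pos_left (Real.log_lt_sub_one_of_pos hy hy1) hr
  linarith

theorem rpow_neg_lt_one_of_one_lt {h r : ℝ} (hh : 1 < h) (hr : 0 < r) : h ^ (-r) < 1 :=
  Real.rpow_lt_one_of_one_lt_of_neg hh (neg_lt_zero.mpr hr)

/-- The point of `(1, h)` at which the chord of `x ↦ x ^ (-r)` over `[1, h]` has the largest
ratio to the function. -/
def chordRatioArgmax (h r : ℝ) : ℝ :=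
  r * (h - h ^ (-r)) / ((r + 1) * (1 - h ^ (-r)))

theorem chordRatioArgmax_pos {h r : ℝ} (hh : 1 < h) (hr : 0 < r) : 0 < chordRatioArgmax h r := by
  have ha := rpow_neg_lt_one_of_one_lt hh hr
  exact div_pos (mul_pos hr (by linarith)) (mul_pos (by linarith) (by linarith))

theorem one_lt_chordRatioArgmax {h r : ℝ} (hh : 1 < h) (hr : 0 < r) :
    1 < chordRatioArgmax h r := by
  have ha := rpow_neg_lt_one_of_one_lt hh hr
  have hb := one_sub_mul_sub_one_lt_rpow_neg (by linarith : 0 < h) hh.ne' hr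
  rw [chordRatioArgmax, one_lt_div (mul_pos (by linarith) (by linarith))]
  linarith

theorem chordRatioArgmax_lt {h r : ℝ} (hh : 1 < h) (hr : 0 < r) : chordRatioArgmax h r < h := by
  have h0 : 0 < h := by linarith
  have ha := rpow_neg_lt_one_of_one_lt hh hr
  have ha0 : 0 < h ^ (-r) := Real.rpow_pos_of_pos h0 _
  have hb := one_sub_mul_sub_one_lt_rpow_neg (inv_pos.mpr h0) (inv_ne_one.mpr hh.ne') hr
  rw [Real.inv_rpow h0.le] at hb
  rw [chordRatioArgmax, div_lt_iff₀ (mul_pos (by linarith) (by linarith))]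
  have hc := mul_lt_mul_of_pos_right hb (mul_pos ha0 h0)
  have e1 : (h ^ (-r))⁻¹ * (h ^ (-r) * h) = h := by field_simp
  have e2 : (1 - r * (h⁻¹ - 1)) * (h ^ (-r) * h) = h ^ (-r) * (h - r * (1 - h)) := by
    field_simp
  rw [e1, e2] at hc
  linarith

theorem Kconst_neg {h r : ℝ} (hh : 1 < h) (hr : 0 < r) :
    Kconst h (-r) = (h - h ^ (-r)) / ((r + 1) * (h - 1)) * chordRatioArgmax h r ^ r := by
  have ha := rpow_neg_lt_one_of_one_lt hh hr
  have hcond : ¬(-r = 0 ∨ -r = 1) := by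
    rintro (h | h) <;> linarith
  rw [Kconst, if_neg hcond]
  have e : ((-r - 1) / -r) * ((h ^ (-r) - 1) / (h ^ (-r) - h)) = (chordRatioArgmax h r)⁻¹ := by
    rw [chordRatioArgmax, inv_div, show -r - 1 = -(r + 1) by ring, neg_div_neg_eq,
      ← neg_sub 1, ← neg_sub h, neg_div_neg_eq, div_mul_div_comm]
  rw [e, Real.inv_rpow (chordRatioArgmax_pos hh hr).le,
    Real.rpow_neg (chordRatioArgmax_pos hh hr).le, inv_inv, ← neg_sub h,
    show (-r - 1) * (h - 1) = -((r + 1) * (h - 1)) by ring, neg_div_neg_eq]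

theorem Kconst_neg_one {h : ℝ} (hh : 1 < h) : Kconst h (-1) = (h + 1) ^ 2 / (4 * h) := by
  have h1 : h - 1 ≠ 0 := by linarith
  have h0 : h ≠ 0 := by linarith
  rw [Kconst_neg hh one_pos, chordRatioArgmax, Real.rpow_one, Real.rpow_neg_one]
  have e : 1 - h⁻¹ ≠ 0 := by
    rw [show 1 - h⁻¹ = (h - 1) / h by field_simp]
    exact div_ne_zero h1 h0
  field_simp
  ring

/-- `K(h, -r)` is the value at `chordRatioArgmax h r` of the ratio of the chord of `x ↦ x ^ (-r)`
over `[1, h]` to the function. -/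
theorem Kconst_neg_eq_chord {h r : ℝ} (hh : 1 < h) (hr : 0 < r) :
    Kconst h (-r) = ((h - chordRatioArgmax h r) / (h - 1) +
      (chordRatioArgmax h r - 1) / (h - 1) * h ^ (-r)) * chordRatioArgmax h r ^ r := by
  have ha := rpow_neg_lt_one_of_one_lt hh hr
  rw [Kconst_neg hh hr]
  congr 1
  rw [chordRatioArgmax]
  have h1 : h - 1 ≠ 0 := by linarith
  have h2 : r + 1 ≠ 0 := by linarith
  have h3 : 1 - h ^ (-r) ≠ 0 := by linarith
  field_simp
  ring

/-- `K(h, -r)` bounds the ratio of the chord of `x ↦ x ^ (-r)` over `[1, h]` to the function. -/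
theorem chord_mul_rpow_le_Kconst_neg {h r x : ℝ} (hh : 1 < h) (hr : 0 < r) (hx : 0 < x) :
    ((h - x) / (h - 1) + (x - 1) / (h - 1) * h ^ (-r)) * x ^ r ≤ Kconst h (-r) := by
  have ha := rpow_neg_lt_one_of_one_lt hh hr
  have hX := chordRatioArgmax_pos hh hr
  have h1 : h - 1 ≠ 0 := by linarith
  have h2 : r + 1 ≠ 0 := by linarith
  have h3 : 1 - h ^ (-r) ≠ 0 := by linarith
  have h4 : h - h ^ (-r) ≠ 0 := by linarith
  have hy : 0 < x / chordRatioArgmax h r := div_pos hx hX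
  have hb := one_sub_mul_sub_one_le_rpow_neg hy hr.le
  rw [Real.rpow_neg hy.le, Real.div_rpow hx.le hX.le, inv_div,
    le_div_iff₀ (Real.rpow_pos_of_pos hx r)] at hb
  have hc : 0 ≤ (h - h ^ (-r)) / ((r + 1) * (h - 1)) :=
    div_nonneg (by linarith) (mul_nonneg (by linarith) (by linarith))
  have e : (h - x) / (h - 1) + (x - 1) / (h - 1) * h ^ (-r) =
      (h - h ^ (-r)) / ((r + 1) * (h - 1)) * (1 - r * (x / chordRatioArgmax h r - 1)) := by
    rw [chordRatioArgmax]
    field_simp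
    ring
  rw [Kconst_neg hh hr, e, mul_assoc]
  exact mul_le_mul_of_nonneg_left hb hc

theorem Kconst_neg_lt {h r : ℝ} (hh : 1 < h) (hr : r ∈ Set.Ioo (0 : ℝ) 1) :
    Kconst h (-r) < ((h + 1) ^ 2 / (4 * h)) ^ r := by
  obtain ⟨hr0, hr1⟩ := hr
  have h0 : 0 < h := by linarith
  have h1 : 0 < h - 1 := by linarith
  have hX := chordRatioArgmax_pos hh hr0
  have hX1 := one_lt_chordRatioArgmax hh hr0
  have hXh := chordRatioArgmax_lt hh hr0
  rw [Kconst_neg_eq_chord hh hr0]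
  set x := chordRatioArgmax h r
  have hJ := (Real.strictConcaveOn_rpow hr0 hr1).2 (x := 1) (y := h⁻¹)
    (Set.mem_Ici.mpr zero_le_one) (Set.mem_Ici.mpr (inv_nonneg.mpr h0.le))
    (inv_ne_one.mpr hh.ne').symm
    (div_pos (sub_pos.mpr hXh) h1) (div_pos (sub_pos.mpr hX1) h1)
    (by field_simp; ring)
  simp only [smul_eq_mul, Real.one_rpow, mul_one, Real.inv_rpow h0.le,
    ← Real.rpow_neg h0.le] at hJ
  have e : (h - x) / (h - 1) + (x - 1) / (h - 1) * h⁻¹ = (h + 1 - x) / h := by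
    field_simp
    ring
  rw [e] at hJ
  have hp : 0 ≤ (h + 1 - x) / h := div_nonneg (by linarith) h0.le
  calc _ < ((h + 1 - x) / h) ^ r * x ^ r :=
        mul_lt_mul_of_pos_right hJ (Real.rpow_pos_of_pos hX r)
    _ = ((h + 1 - x) / h * x) ^ r := (Real.mul_rpow hp hX.le).symm
    _ ≤ ((h + 1) ^ 2 / (4 * h)) ^ r := by
        refine Real.rpow_le_rpow (mul_nonneg hp hX.le) ?_ hr0.le
        rw [div_mul_eq_mul_div, div_le_div_iff₀ h0 (by linarith)]
        nlinarith [mul_nonneg h0.le (sq_nonneg (h + 1 - 2 * x))]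

theorem le_Kconst_neg {h r : ℝ} (hh : 1 < h) (hr : 1 ≤ r) :
    ((h + 1) ^ 2 / (4 * h)) ^ r ≤ Kconst h (-r) := by
  have h0 : 0 < h := by linarith
  have h1 : h - 1 ≠ 0 := by linarith
  have hx : 0 < (h + 1) / 2 := by linarith
  have hJ := (convexOn_rpow hr).2
    (Set.mem_Ici.mpr (zero_le_one' ℝ)) (Set.mem_Ici.mpr (inv_nonneg.mpr h0.le))
    one_half_pos.le one_half_pos.le (add_halves (1 : ℝ))
  simp only [smul_eq_mul, Real.one_rpow, mul_one, Real.inv_rpow h0.le,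
    ← Real.rpow_neg h0.le] at hJ
  have hK := chord_mul_rpow_le_Kconst_neg hh (by linarith : 0 < r) hx
  have e1 : (h - (h + 1) / 2) / (h - 1) = 1 / 2 := by
    field_simp
    ring
  have e2 : ((h + 1) / 2 - 1) / (h - 1) = 1 / 2 := by
    field_simp
    ring
  rw [e1, e2] at hK
  refine le_trans ?_ hK
  have hp : 0 ≤ 1 / 2 + 1 / 2 * h⁻¹ := by positivity
  have e3 : (h + 1) ^ 2 / (4 * h) = (1 / 2 + 1 / 2 * h⁻¹) * ((h + 1) / 2) := by
    field_simp
    ring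
  rw [e3, Real.mul_rpow hp hx.le]
  exact mul_le_mul_of_nonneg_right hJ (Real.rpow_nonneg hx.le r)

theorem stmt16 (h : ℝ) (hh : 1 < h) :
    (∀ r ∈ Set.Ioo (0 : ℝ) 1, Kconst h (-r) ≤ Kconst h (-1) ^ r) ∧
    (∀ r : ℝ, 1 ≤ r → Kconst h (-1) ^ r ≤ Kconst h (-r)) ∧
    Kconst h (-1) = (h + 1) ^ 2 / (4 * h) ∧
    (∀ m M : ℝ, 0 < m → m < M → h = M / m →
      ∀ r ∈ Set.Ioo (0 : ℝ) 1, Kconst h (-r) < ((M + m) ^ 2 / (4 * M * m)) ^ r) := by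
  rw [Kconst_neg_one hh]
  refine ⟨fun r hr => (Kconst_neg_lt hh hr).le, fun r hr => le_Kconst_neg hh hr, rfl, ?_⟩
  intro m M hm hmM hMm r hr
  have hM : 0 < M := hm.trans hmM
  have e : (M + m) ^ 2 / (4 * M * m) = (h + 1) ^ 2 / (4 * h) := by
    rw [hMm]
    field_simp
  rw [e]
  exact Kconst_neg_lt hh hr
end
end
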